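/- arXiv:2106.09469 — 3 statements merged into one kernel-verified Lean document; each statement's English description precedes it below -/
import Mathlib

section
/- Let H be a real inner product space, let e ∈ H, and let F : H → ℝ be a continuous linear functional. Define the Galerkin functional G : H → ℝ by G(ψ) := ⟨e, ψ⟩ + F(ψ). Then ‖e‖² + ‖F‖² ≤ 5·‖G‖² − 6·F(e), where ‖F‖ and ‖G‖ denote operator norms. -/
open RealInnerProductSpace

/-- Abstract form of (eq:UpperBoundAbstract): `‖e‖² + ‖F‖² ≤ 5‖G‖² − 6·F(e)`. -/
theorem error_measure_sq_le_galerkin {H : Type*} [NormedAddCommGroup H]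
    [InnerProductSpace ℝ H]
    (e : H) (F : H →L[ℝ] ℝ) (G : H →L[ℝ] ℝ)
    (hG : ∀ ψ : H, G ψ = ⟪e, ψ⟫ + F ψ) :
    ‖e‖ ^ 2 + ‖F‖ ^ 2 ≤ 5 * ‖G‖ ^ 2 - 6 * F e := by
  have hF : F = G - innerSL ℝ e := by
    ext ψ
    simp [hG]
  have hFnorm : ‖F‖ ≤ ‖G‖ + ‖e‖ := by
    simpa [← hF] using norm_sub_le G (innerSL ℝ e)
  have hFe : F e = G e - ‖e‖ ^ 2 := by
    rw [hG, real_inner_self_eq_norm_sq]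
    ring
  have hGe : G e ≤ ‖G‖ * ‖e‖ := (le_abs_self _).trans (G.le_opNorm e)
  have hFsq : ‖F‖ ^ 2 ≤ (‖G‖ + ‖e‖) ^ 2 := by gcongr
  rw [hFe]
  nlinarith [sq_nonneg (‖G‖ - ‖e‖)]
end

section
/- Let H be a real inner product space, let e ∈ H, and let F : H → ℝ be a continuous linear functional. Define the Galerkin functional G : H → ℝ by G(ψ) := ⟨e, ψ⟩ + F(ψ). Then (‖e‖ + ‖F‖)² ≤ 10·‖G‖² − 12·F(e), where ‖F‖ and ‖G‖ denote operator norms. In particular, if ‖G‖ ≤ A and −F(e) ≤ B² for nonnegative reals A, B, then ‖e‖ + ‖F‖ ≤ √10·A + √12·B. -/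
open RealInnerProductSpace

/-- Abstract core of the reliability Theorem 3.1:
`(‖e‖ + ‖F‖)² ≤ 10‖G‖² − 12·F(e)`, and consequently, if `‖G‖ ≤ A` and `−F(e) ≤ B²`
for nonnegative `A`, `B`, then `‖e‖ + ‖F‖ ≤ √10·A + √12·B`. -/
theorem reliability_abstract {H : Type*} [NormedAddCommGroup H] [InnerProductSpace ℝ H]
    (e : H) (F : H →L[ℝ] ℝ) (G : H →L[ℝ] ℝ)
    (hG : ∀ ψ : H, G ψ = ⟪e, ψ⟫ + F ψ) :
    (‖e‖ + ‖F‖) ^ 2 ≤ 10 * ‖G‖ ^ 2 - 12 * F e ∧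
    ∀ A B : ℝ, 0 ≤ A → 0 ≤ B → ‖G‖ ≤ A → -F e ≤ B ^ 2 →
      ‖e‖ + ‖F‖ ≤ Real.sqrt 10 * A + Real.sqrt 12 * B := by
  have hF : ‖F‖ ≤ ‖G‖ + ‖e‖ := by
    have hFG : F = G - innerSL ℝ e := by
      ext ψ
      simp [hG]
    calc ‖F‖ = ‖G - innerSL ℝ e‖ := by rw [hFG]
      _ ≤ ‖G‖ + ‖innerSL ℝ e‖ := norm_sub_le _ _
      _ = ‖G‖ + ‖e‖ := by rw [innerSL_apply_norm]
  have hFe : F e ≤ ‖G‖ * ‖e‖ - ‖e‖ ^ 2 := by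
    have hGe : G e ≤ ‖G‖ * ‖e‖ := (le_abs_self _).trans (G.le_opNorm e)
    rw [hG, real_inner_self_eq_norm_sq] at hGe
    linarith
  have hsq : (‖e‖ + ‖F‖) ^ 2 ≤ 10 * ‖G‖ ^ 2 - 12 * F e :=
    calc (‖e‖ + ‖F‖) ^ 2 ≤ (‖e‖ + (‖G‖ + ‖e‖)) ^ 2 := by gcongr
      _ ≤ 10 * ‖G‖ ^ 2 - 12 * F e := by
        nlinarith [sq_nonneg (‖e‖ - ‖G‖), sq_nonneg ‖G‖]
  refine ⟨hsq, fun A B hA hB hGA hFB => ?_⟩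
  have hGA2 : ‖G‖ ^ 2 ≤ A ^ 2 := by gcongr
  refine abs_le_of_sq_le_sq' ?_ (by positivity) |>.2
  have h10 : √(10 : ℝ) ^ 2 = 10 := Real.sq_sqrt (by norm_num)
  have h12 : √(12 : ℝ) ^ 2 = 12 := Real.sq_sqrt (by norm_num)
  have hcross : 0 ≤ √(10 : ℝ) * A * (√12 * B) := by positivity
  rw [add_sq (√10 * A), mul_pow, mul_pow, h10, h12]
  linarith
end

section
/- Let μ, λ ∈ ℝ, let Q be a 2×2 real orthogonal matrix (Qᵀ·Q = 1), and let d : Fin 2 → ℝ. Set E := Q·diagonal(d)·Qᵀ, E⁺ := Q·diagonal(fun i => max (d i) 0)·Qᵀ, and σ⁺ := 2μ·E⁺ + λ·max 0 (trace E)·(1 : Matrix (Fin 2) (Fin 2) ℝ). Then the Frobenius inner product σ⁺ : E = trace(σ⁺·E) equals 2μ·((max (d 0) 0)² + (max (d 1) 0)²) + λ·(max 0 (d 0 + d 1))². In particular, if μ ≥ 0 and λ ≥ 0 then σ⁺ : E ≥ 0. -/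
open Matrix

section OrthogonalConjugation

variable {n R : Type*} [Fintype n] [DecidableEq n] [CommRing R]

theorem trace_orthogonal_conj_diagonal {Q : Matrix n n R} (hQ : Qᵀ * Q = 1) (d : n → R) :
    (Q * diagonal d * Qᵀ).trace = ∑ i, d i := by
  rw [trace_mul_comm, ← Matrix.mul_assoc, hQ, Matrix.one_mul, trace_diagonal]

theorem orthogonal_conj_diagonal_mul {Q : Matrix n n R} (hQ : Qᵀ * Q = 1) (c d : n → R) :
    Q * diagonal c * Qᵀ * (Q * diagonal d * Qᵀ) = Q * diagonal (fun i => c i * d i) * Qᵀ := by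
  calc Q * diagonal c * Qᵀ * (Q * diagonal d * Qᵀ)
      = Q * diagonal c * (Qᵀ * Q) * diagonal d * Qᵀ := by simp only [Matrix.mul_assoc]
    _ = Q * diagonal (fun i => c i * d i) * Qᵀ := by
      rw [hQ, Matrix.mul_one, Matrix.mul_assoc Q, diagonal_mul_diagonal]

end OrthogonalConjugation

theorem max_zero_mul_self_eq_sq (x : ℝ) : max x 0 * x = max x 0 ^ 2 := by
  rcases le_total x 0 with h | h <;> simp [h, sq]

/-- Positive definiteness computation (eq:posdef) for the Miehe stress splitting:
`σ⁺ : E = 2μ·tr((D⁺)²) + λ·max{0, tr E}² ≥ 0`. -/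
theorem stress_splitting_posdef (μ lam : ℝ) (Q : Matrix (Fin 2) (Fin 2) ℝ)
    (hQ : Qᵀ * Q = 1) (d : Fin 2 → ℝ) :
    let E := Q * Matrix.diagonal d * Qᵀ
    let Ep := Q * Matrix.diagonal (fun i => max (d i) 0) * Qᵀ
    let σp := (2 * μ) • Ep + (lam * max 0 E.trace) • (1 : Matrix (Fin 2) (Fin 2) ℝ)
    (σp * E).trace
      = 2 * μ * ((max (d 0) 0) ^ 2 + (max (d 1) 0) ^ 2)
        + lam * (max 0 (d 0 + d 1)) ^ 2 ∧
    (0 ≤ μ → 0 ≤ lam → 0 ≤ (σp * E).trace) := by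
  intro E Ep σp
  have trace_eq : (σp * E).trace
      = 2 * μ * ((max (d 0) 0) ^ 2 + (max (d 1) 0) ^ 2)
        + lam * (max 0 (d 0 + d 1)) ^ 2 := by
    have hE : E.trace = d 0 + d 1 := by
      rw [trace_orthogonal_conj_diagonal hQ, Fin.sum_univ_two]
    have hEpE : (Ep * E).trace = max (d 0) 0 ^ 2 + max (d 1) 0 ^ 2 := by
      simp only [Ep, E, orthogonal_conj_diagonal_mul hQ, trace_orthogonal_conj_diagonal hQ,
        Fin.sum_univ_two, max_zero_mul_self_eq_sq]
    simp only [σp, Matrix.add_mul, Matrix.smul_mul, Matrix.one_mul, trace_add, trace_smul,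
      smul_eq_mul, hEpE, hE]
    rw [mul_assoc lam, max_comm 0, max_zero_mul_self_eq_sq]
  refine ⟨trace_eq, fun hμ hlam => ?_⟩
  rw [trace_eq]
  positivity
end
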